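/- Existence of principal types in the cumulative undirected system: if ⊢ Γ and Γ ⊢ t : T is derivable in the cumulative undirected system, then there exists a term P such that Γ ⊢ t : P and, for every T' with Γ ⊢ t : T' in the cumulative undirected system, P ≼ T'. -/

import Mathlib

/-! Formalization of CCω (terms, reduction, conversion, undirected and
bidirectional typing, cumulativity) using de Bruijn indices, following
Lennon-Bertrand, "Complete Bidirectional Typing for the Calculus of
Inductive Constructions". -/

namespace CComega

/-- Terms of CCω: `t ::= x | □_i | Πx:t.t | λx:t.t | t t`,
with variables as de Bruijn indices. -/
inductive Tm : Type
  | var : ℕ → Tm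
  | sort : ℕ → Tm
  | pi : Tm → Tm → Tm
  | lam : Tm → Tm → Tm
  | app : Tm → Tm → Tm
deriving DecidableEq

/-- `lift n k t` shifts by `n` the de Bruijn indices of `t` that are ≥ `k`. -/
def lift (n k : ℕ) : Tm → Tm
  | .var i => if i < k then .var i else .var (i + n)
  | .sort i => .sort i
  | .pi A B => .pi (lift n k A) (lift n (k + 1) B)
  | .lam A t => .lam (lift n k A) (lift n (k + 1) t)
  | .app t u => .app (lift n k t) (lift n k u)

/-- `subst u k t` is the capture-avoiding substitution `t[u/k]` of `u`
for de Bruijn index `k` in `t`. -/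
def subst (u : Tm) (k : ℕ) : Tm → Tm
  | .var i => if i < k then .var i else if i = k then lift k 0 u else .var (i - 1)
  | .sort i => .sort i
  | .pi A B => .pi (subst u k A) (subst u (k + 1) B)
  | .lam A t => .lam (subst u k A) (subst u (k + 1) t)
  | .app t v => .app (subst u k t) (subst u k v)

/-- One-step reduction `t → t'`: the least congruence such that
`(λx:A.t) u → t[u/x]`. -/
inductive Red : Tm → Tm → Prop
  | beta (A t u : Tm) : Red (.app (.lam A t) u) (subst u 0 t)
  | piDom {A A'} (B : Tm) : Red A A' → Red (.pi A B) (.pi A' B)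
  | piCod (A : Tm) {B B'} : Red B B' → Red (.pi A B) (.pi A B')
  | lamDom {A A'} (t : Tm) : Red A A' → Red (.lam A t) (.lam A' t)
  | lamBody (A : Tm) {t t'} : Red t t' → Red (.lam A t) (.lam A t')
  | appFun {t t'} (u : Tm) : Red t t' → Red (.app t u) (.app t' u)
  | appArg (t : Tm) {u u'} : Red u u' → Red (.app t u) (.app t u')

/-- Multi-step reduction `t ↠ t'`: reflexive-transitive closure of `→`. -/
def Reds : Tm → Tm → Prop := Relation.ReflTransGen Red

/-- Conversion `t ≡ u`: symmetric, reflexive, transitive closure of `→`. -/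
def Conv : Tm → Tm → Prop := Relation.EqvGen Red

/-- Contexts are lists of (de Bruijn) declarations, most recent first. -/
abbrev Ctx := List Tm

mutual
/-- Context well-formedness `⊢ Γ`. -/
inductive WfCtx : Ctx → Prop
  | nil : WfCtx []
  | cons {Γ A i} : WfCtx Γ → Typed Γ A (.sort i) → WfCtx (A :: Γ)

/-- Undirected typing `Γ ⊢ t : T`. -/
inductive Typed : Ctx → Tm → Tm → Prop
  | sort {Γ i} : WfCtx Γ → Typed Γ (.sort i) (.sort (i + 1))
  | var {Γ n A} : WfCtx Γ → Γ[n]? = some A → Typed Γ (.var n) (lift (n + 1) 0 A)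
  | pi {Γ A B i j} : Typed Γ A (.sort i) → Typed (A :: Γ) B (.sort j) →
      Typed Γ (.pi A B) (.sort (max i j))
  | lam {Γ A B t i} : Typed Γ (.pi A B) (.sort i) → Typed (A :: Γ) t B →
      Typed Γ (.lam A t) (.pi A B)
  | app {Γ t u A B} : Typed Γ t (.pi A B) → Typed Γ u A →
      Typed Γ (.app t u) (subst u 0 B)
  | conv {Γ t A B i} : Typed Γ t A → Typed Γ B (.sort i) → Conv A B →
      Typed Γ t B
end

mutual
/-- Bidirectional inference `Γ ⊢ t ▹ T`. -/
inductive Infer : Ctx → Tm → Tm → Prop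
  | sort {Γ i} : Infer Γ (.sort i) (.sort (i + 1))
  | var {Γ n A} : Γ[n]? = some A → Infer Γ (.var n) (lift (n + 1) 0 A)
  | pi {Γ A B i j} : InferSort Γ A (.sort i) → InferSort (A :: Γ) B (.sort j) →
      Infer Γ (.pi A B) (.sort (max i j))
  | lam {Γ A t B i} : InferSort Γ A (.sort i) → Infer (A :: Γ) t B →
      Infer Γ (.lam A t) (.pi A B)
  | app {Γ t u A B} : InferPi Γ t (.pi A B) → Check Γ u A →
      Infer Γ (.app t u) (subst u 0 B)

/-- Bidirectional checking `Γ ⊢ t ◃ T`. -/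
inductive Check : Ctx → Tm → Tm → Prop
  | check {Γ t T T'} : Infer Γ t T' → Conv T' T → Check Γ t T

/-- Constrained inference `Γ ⊢ t ▹_□ T` (the output is a universe). -/
inductive InferSort : Ctx → Tm → Tm → Prop
  | inferSort {Γ t T i} : Infer Γ t T → Reds T (.sort i) → InferSort Γ t (.sort i)

/-- Constrained inference `Γ ⊢ t ▹_Π T` (the output is a product type). -/
inductive InferPi : Ctx → Tm → Tm → Prop
  | inferPi {Γ t T A B} : Infer Γ t T → Reds T (.pi A B) → InferPi Γ t (.pi A B)
end

/-- Weak-head reduction `t ⇝ t'`: reduction only at the head. -/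
inductive WhRed : Tm → Tm → Prop
  | beta (A t u : Tm) : WhRed (.app (.lam A t) u) (subst u 0 t)
  | appFun {t t'} (u : Tm) : WhRed t t' → WhRed (.app t u) (.app t' u)

/-- Multi-step weak-head reduction `t ⇝* t'`. -/
def WhReds : Tm → Tm → Prop := Relation.ReflTransGen WhRed

mutual
/-- Weak-head bidirectional inference: as `Infer`, but constrained inference
uses weak-head reduction. -/
inductive InferW : Ctx → Tm → Tm → Prop
  | sort {Γ i} : InferW Γ (.sort i) (.sort (i + 1))
  | var {Γ n A} : Γ[n]? = some A → InferW Γ (.var n) (lift (n + 1) 0 A)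
  | pi {Γ A B i j} : InferSortW Γ A (.sort i) → InferSortW (A :: Γ) B (.sort j) →
      InferW Γ (.pi A B) (.sort (max i j))
  | lam {Γ A t B i} : InferSortW Γ A (.sort i) → InferW (A :: Γ) t B →
      InferW Γ (.lam A t) (.pi A B)
  | app {Γ t u A B} : InferPiW Γ t (.pi A B) → CheckW Γ u A →
      InferW Γ (.app t u) (subst u 0 B)

/-- Weak-head bidirectional checking. -/
inductive CheckW : Ctx → Tm → Tm → Prop
  | check {Γ t T T'} : InferW Γ t T' → Conv T' T → CheckW Γ t T

/-- Weak-head constrained inference `Γ ⊢ t ▹_□ T`. -/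
inductive InferSortW : Ctx → Tm → Tm → Prop
  | inferSort {Γ t T i} : InferW Γ t T → WhReds T (.sort i) →
      InferSortW Γ t (.sort i)

/-- Weak-head constrained inference `Γ ⊢ t ▹_Π T`. -/
inductive InferPiW : Ctx → Tm → Tm → Prop
  | inferPi {Γ t T A B} : InferW Γ t T → WhReds T (.pi A B) →
      InferPiW Γ t (.pi A B)
end

/-- Cumulativity `t ≼ u`: the least transitive relation containing conversion
such that `□_i ≼ □_j` whenever `i ≤ j` and `Πx:A.B ≼ Πx:A'.B'` whenever
`A ≡ A'` and `B ≼ B'`. -/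
inductive Cum : Tm → Tm → Prop
  | ofConv {t u} : Conv t u → Cum t u
  | sort {i j : ℕ} : i ≤ j → Cum (.sort i) (.sort j)
  | pi {A A' B B'} : Conv A A' → Cum B B' → Cum (.pi A B) (.pi A' B')
  | trans {t u v} : Cum t u → Cum u v → Cum t v

mutual
/-- Context well-formedness for the cumulative undirected system. -/
inductive WfCtxC : Ctx → Prop
  | nil : WfCtxC []
  | cons {Γ A i} : WfCtxC Γ → TypedC Γ A (.sort i) → WfCtxC (A :: Γ)

/-- Cumulative undirected typing `Γ ⊢ t : T`: as `Typed`, with the conversion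
rule replaced by cumulativity. -/
inductive TypedC : Ctx → Tm → Tm → Prop
  | sort {Γ i} : WfCtxC Γ → TypedC Γ (.sort i) (.sort (i + 1))
  | var {Γ n A} : WfCtxC Γ → Γ[n]? = some A → TypedC Γ (.var n) (lift (n + 1) 0 A)
  | pi {Γ A B i j} : TypedC Γ A (.sort i) → TypedC (A :: Γ) B (.sort j) →
      TypedC Γ (.pi A B) (.sort (max i j))
  | lam {Γ A B t i} : TypedC Γ (.pi A B) (.sort i) → TypedC (A :: Γ) t B →
      TypedC Γ (.lam A t) (.pi A B)
  | app {Γ t u A B} : TypedC Γ t (.pi A B) → TypedC Γ u A →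
      TypedC Γ (.app t u) (subst u 0 B)
  | cumul {Γ t A B i} : TypedC Γ t A → TypedC Γ B (.sort i) → Cum A B →
      TypedC Γ t B
end

mutual
/-- Cumulative bidirectional inference `Γ ⊢ t ▹ T`. -/
inductive InferC : Ctx → Tm → Tm → Prop
  | sort {Γ i} : InferC Γ (.sort i) (.sort (i + 1))
  | var {Γ n A} : Γ[n]? = some A → InferC Γ (.var n) (lift (n + 1) 0 A)
  | pi {Γ A B i j} : InferSortC Γ A (.sort i) → InferSortC (A :: Γ) B (.sort j) →
      InferC Γ (.pi A B) (.sort (max i j))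
  | lam {Γ A t B i} : InferSortC Γ A (.sort i) → InferC (A :: Γ) t B →
      InferC Γ (.lam A t) (.pi A B)
  | app {Γ t u A B} : InferPiC Γ t (.pi A B) → CheckC Γ u A →
      InferC Γ (.app t u) (subst u 0 B)

/-- Cumulative bidirectional checking `Γ ⊢ t ◃ T`, using cumulativity. -/
inductive CheckC : Ctx → Tm → Tm → Prop
  | check {Γ t T T'} : InferC Γ t T' → Cum T' T → CheckC Γ t T

/-- Cumulative constrained inference `Γ ⊢ t ▹_□ T` (unchanged: uses reduction). -/
inductive InferSortC : Ctx → Tm → Tm → Prop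
  | inferSort {Γ t T i} : InferC Γ t T → Reds T (.sort i) → InferSortC Γ t (.sort i)

/-- Cumulative constrained inference `Γ ⊢ t ▹_Π T` (unchanged: uses reduction). -/
inductive InferPiC : Ctx → Tm → Tm → Prop
  | inferPi {Γ t T A B} : InferC Γ t T → Reds T (.pi A B) → InferPiC Γ t (.pi A B)
end

/-! ### Renamings and simultaneous substitutions -/

/-- Extension of a renaming under a binder. -/
def upRen (ξ : ℕ → ℕ) : ℕ → ℕ
  | 0 => 0
  | n + 1 => ξ n + 1

/-- Simultaneous renaming of the variables of a term. -/
def ren (ξ : ℕ → ℕ) : Tm → Tm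
  | .var i => .var (ξ i)
  | .sort i => .sort i
  | .pi A B => .pi (ren ξ A) (ren (upRen ξ) B)
  | .lam A t => .lam (ren ξ A) (ren (upRen ξ) t)
  | .app t u => .app (ren ξ t) (ren ξ u)

/-- Extension of a substitution under a binder. -/
def up (σ : ℕ → Tm) : ℕ → Tm
  | 0 => .var 0
  | n + 1 => ren Nat.succ (σ n)

/-- Simultaneous substitution. -/
def inst (σ : ℕ → Tm) : Tm → Tm
  | .var i => σ i
  | .sort i => .sort i
  | .pi A B => .pi (inst σ A) (inst (up σ) B)
  | .lam A t => .lam (inst σ A) (inst (up σ) t)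
  | .app t u => .app (inst σ t) (inst σ u)

/-- The substitution sending `0` to `u` and `n + 1` to `var n`. -/
def single (u : Tm) : ℕ → Tm
  | 0 => u
  | n + 1 => .var n

theorem up_var_comp (ξ : ℕ → ℕ) : up (fun n => .var (ξ n)) = fun n => .var (upRen ξ n) := by
  funext n; cases n <;> rfl

theorem ren_eq_inst (ξ : ℕ → ℕ) (t : Tm) : ren ξ t = inst (fun n => .var (ξ n)) t := by
  induction t generalizing ξ <;> simp_all [ren, inst, up_var_comp]

theorem inst_var (t : Tm) : inst Tm.var t = t := by
  have h : up Tm.var = Tm.var := by funext n; cases n <;> rfl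
  induction t <;> simp_all [inst]

theorem inst_ren (σ : ℕ → Tm) (ξ : ℕ → ℕ) (t : Tm) :
    inst σ (ren ξ t) = inst (fun n => σ (ξ n)) t := by
  have h (σ : ℕ → Tm) (ξ : ℕ → ℕ) : (fun n => up σ (upRen ξ n)) = up (fun n => σ (ξ n)) := by
    funext n; cases n <;> rfl
  induction t generalizing ξ σ <;> simp_all [ren, inst]

theorem ren_ren (ξ ζ : ℕ → ℕ) (t : Tm) : ren ζ (ren ξ t) = ren (fun n => ζ (ξ n)) t := by
  rw [ren_eq_inst ζ, inst_ren, ren_eq_inst]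

theorem ren_inst (σ : ℕ → Tm) (ξ : ℕ → ℕ) (t : Tm) :
    ren ξ (inst σ t) = inst (fun n => ren ξ (σ n)) t := by
  have h (σ : ℕ → Tm) (ξ : ℕ → ℕ) :
      (fun n => ren (upRen ξ) (up σ n)) = up (fun n => ren ξ (σ n)) := by
    funext n; cases n with
    | zero => rfl
    | succ n => simp only [up, ren_ren]; rfl
  induction t generalizing ξ σ <;> simp_all [ren, inst]

theorem inst_inst (σ τ : ℕ → Tm) (t : Tm) :
    inst τ (inst σ t) = inst (fun n => inst τ (σ n)) t := by
  have h (σ τ : ℕ → Tm) : (fun n => inst (up τ) (up σ n)) = up (fun n => inst τ (σ n)) := by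
    funext n; cases n with
    | zero => rfl
    | succ n => simp only [up, inst_ren, ren_inst]
  induction t generalizing σ τ <;> simp_all [inst]

theorem lift_eq_ren (n k : ℕ) (t : Tm) :
    lift n k t = ren (fun i => if i < k then i else i + n) t := by
  have h (k : ℕ) : upRen (fun i => if i < k then i else i + n) =
      fun i => if i < k + 1 then i else i + n := by
    funext i; cases i with
    | zero => simp [upRen]
    | succ i => simp only [upRen]; split_ifs <;> omega
  induction t generalizing k <;> simp_all [ren, lift]
  split_ifs <;> rfl

theorem lift_zero_eq_ren (n : ℕ) (t : Tm) : lift n 0 t = ren (fun i => i + n) t := by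
  simp [lift_eq_ren]

theorem subst_eq_inst (u : Tm) (k : ℕ) (t : Tm) :
    subst u k t = inst (fun i => if i < k then .var i else
      if i = k then lift k 0 u else .var (i - 1)) t := by
  have h (k : ℕ) : up (fun i => if i < k then .var i else
      if i = k then lift k 0 u else .var (i - 1)) =
      fun i => if i < k + 1 then .var i else
        if i = k + 1 then lift (k + 1) 0 u else .var (i - 1) := by
    funext i; cases i with
    | zero => simp [up]
    | succ i =>
      rcases lt_trichotomy i k with h | h | h
      · simp [up, h, ren]
      · subst h
        simp only [up, lt_irrefl, if_true, if_false, lift_zero_eq_ren, ren_ren]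
        rfl
      · have h1 : ¬ i < k := by omega
        have h2 : i ≠ k := by omega
        simp only [up, h1, h2, if_false, ren, Nat.add_lt_add_iff_right, Nat.add_right_cancel_iff]
        congr 1; omega
  induction t generalizing k <;> simp_all [subst, inst]

theorem subst_zero_eq_inst (u t : Tm) : subst u 0 t = inst (single u) t := by
  rw [subst_eq_inst]
  congr 1; funext i
  cases i with
  | zero => simp [single, lift_zero_eq_ren, ren_eq_inst, inst_var]
  | succ i => simp [single]

theorem inst_single_ren_succ (u t : Tm) : inst (single u) (ren Nat.succ t) = t := by
  rw [inst_ren]; exact inst_var t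

theorem inst_subst_zero (σ : ℕ → Tm) (u t : Tm) :
    inst σ (subst u 0 t) = subst (inst σ u) 0 (inst (up σ) t) := by
  simp only [subst_zero_eq_inst, inst_inst]
  congr 1; funext i
  cases i with
  | zero => rfl
  | succ i => simp [up, inst_single_ren_succ, single, inst]

theorem lift_succ_zero (n : ℕ) (t : Tm) : lift (n + 1) 0 t = ren Nat.succ (lift n 0 t) := by
  simp only [lift_zero_eq_ren, ren_ren]; rfl

theorem inst_up_ren_succ (σ : ℕ → Tm) (t : Tm) :
    inst (up σ) (ren Nat.succ t) = ren Nat.succ (inst σ t) := by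
  rw [inst_ren, ren_inst]; rfl

theorem lift_zero_zero (t : Tm) : lift 0 0 t = t := by
  rw [lift_zero_eq_ren, ren_eq_inst]; exact inst_var t

/-! ### Parallel reduction and confluence -/

/-- Parallel reduction. -/
inductive Par : Tm → Tm → Prop
  | var (i : ℕ) : Par (.var i) (.var i)
  | sort (i : ℕ) : Par (.sort i) (.sort i)
  | pi {A A' B B'} : Par A A' → Par B B' → Par (.pi A B) (.pi A' B')
  | lam {A A' t t'} : Par A A' → Par t t' → Par (.lam A t) (.lam A' t')
  | app {t t' u u'} : Par t t' → Par u u' → Par (.app t u) (.app t' u')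
  | beta {A t t' u u'} : Par t t' → Par u u' → Par (.app (.lam A t) u) (subst u' 0 t')

theorem Par.refl : ∀ t, Par t t
  | .var i => .var i
  | .sort i => .sort i
  | .pi A B => .pi (refl A) (refl B)
  | .lam A t => .lam (refl A) (refl t)
  | .app t u => .app (refl t) (refl u)

theorem Par.of_red {t u : Tm} (h : Red t u) : Par t u := by
  induction h with
  | beta A t u => exact .beta (.refl _) (.refl _)
  | piDom B _ ih => exact .pi ih (.refl _)
  | piCod A _ ih => exact .pi (.refl _) ih
  | lamDom t _ ih => exact .lam ih (.refl _)
  | lamBody A _ ih => exact .lam (.refl _) ih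
  | appFun u _ ih => exact .app ih (.refl _)
  | appArg t _ ih => exact .app (.refl _) ih

theorem Reds.pi {A A' B B' : Tm} (hA : Reds A A') (hB : Reds B B') :
    Reds (.pi A B) (.pi A' B') :=
  (hA.lift (Tm.pi · B) fun _ _ h => .piDom B h).trans
    (hB.lift (Tm.pi A' ·) fun _ _ h => .piCod A' h)

theorem Reds.lam {A A' t t' : Tm} (hA : Reds A A') (ht : Reds t t') :
    Reds (.lam A t) (.lam A' t') :=
  (hA.lift (Tm.lam · t) fun _ _ h => .lamDom t h).trans
    (ht.lift (Tm.lam A' ·) fun _ _ h => .lamBody A' h)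

theorem Reds.app {t t' u u' : Tm} (ht : Reds t t') (hu : Reds u u') :
    Reds (.app t u) (.app t' u') :=
  (ht.lift (Tm.app · u) fun _ _ h => .appFun u h).trans
    (hu.lift (Tm.app t' ·) fun _ _ h => .appArg t' h)

theorem Par.reds {t u : Tm} (h : Par t u) : Reds t u := by
  induction h with
  | var i => exact .refl
  | sort i => exact .refl
  | pi _ _ ih₁ ih₂ => exact ih₁.pi ih₂
  | lam _ _ ih₁ ih₂ => exact ih₁.lam ih₂
  | app _ _ ih₁ ih₂ => exact ih₁.app ih₂
  | beta _ _ ih₁ ih₂ => exact (Reds.app (Reds.lam .refl ih₁) ih₂).tail (.beta _ _ _)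

theorem Par.ren {t t' : Tm} (h : Par t t') (ξ : ℕ → ℕ) :
    Par (CComega.ren ξ t) (CComega.ren ξ t') := by
  induction h generalizing ξ with
  | var i => exact .var _
  | sort i => exact .sort _
  | pi _ _ ih₁ ih₂ => exact .pi (ih₁ _) (ih₂ _)
  | lam _ _ ih₁ ih₂ => exact .lam (ih₁ _) (ih₂ _)
  | app _ _ ih₁ ih₂ => exact .app (ih₁ _) (ih₂ _)
  | beta _ _ ih₁ ih₂ =>
    rw [ren_eq_inst ξ (CComega.subst _ _ _), inst_subst_zero, up_var_comp,
      ← ren_eq_inst, ← ren_eq_inst]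
    exact .beta (ih₁ _) (ih₂ _)

theorem Par.up {σ σ' : ℕ → Tm} (h : ∀ n, Par (σ n) (σ' n)) :
    ∀ n, Par (CComega.up σ n) (CComega.up σ' n)
  | 0 => .var 0
  | n + 1 => (h n).ren _

theorem Par.inst {t t' : Tm} (h : Par t t') {σ σ' : ℕ → Tm} (hσ : ∀ n, Par (σ n) (σ' n)) :
    Par (CComega.inst σ t) (CComega.inst σ' t') := by
  induction h generalizing σ σ' with
  | var i => exact hσ i
  | sort i => exact .sort _
  | pi _ _ ih₁ ih₂ => exact .pi (ih₁ hσ) (ih₂ (up hσ))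
  | lam _ _ ih₁ ih₂ => exact .lam (ih₁ hσ) (ih₂ (up hσ))
  | app _ _ ih₁ ih₂ => exact .app (ih₁ hσ) (ih₂ hσ)
  | beta _ _ ih₁ ih₂ =>
    rw [inst_subst_zero]
    exact .beta (ih₁ (up hσ)) (ih₂ hσ)

theorem Par.subst {t t' u u' : Tm} (ht : Par t t') (hu : Par u u') :
    Par (CComega.subst u 0 t) (CComega.subst u' 0 t') := by
  simp only [subst_zero_eq_inst]
  refine ht.inst fun n => ?_
  cases n with
  | zero => exact hu
  | succ n => exact .refl _

/-- Complete development: contracts all redexes of a term simultaneously. -/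
def develop : Tm → Tm
  | .var i => .var i
  | .sort i => .sort i
  | .pi A B => .pi (develop A) (develop B)
  | .lam A t => .lam (develop A) (develop t)
  | .app (.lam _ t) u => subst (develop u) 0 (develop t)
  | .app t u => .app (develop t) (develop u)

theorem Par.develop {t u : Tm} (h : Par t u) : Par u (develop t) := by
  induction h with
  | var i => exact .var _
  | sort i => exact .sort _
  | pi _ _ ih₁ ih₂ => exact .pi ih₁ ih₂
  | lam _ _ ih₁ ih₂ => exact .lam ih₁ ih₂
  | beta _ _ ih₁ ih₂ => exact ih₁.subst ih₂
  | @app t t' u u' h₁ h₂ ih₁ ih₂ =>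
    cases t with
    | lam A b =>
      cases h₁ with
      | lam hA hb =>
        cases ih₁ with
        | lam _ hb' => exact .beta hb' ih₂
    | _ => exact .app ih₁ ih₂

theorem reds_iff_reflTransGen_par {t u : Tm} : Reds t u ↔ Relation.ReflTransGen Par t u := by
  constructor
  · exact fun h => Relation.ReflTransGen.mono (fun _ _ => Par.of_red) _ _ h
  · intro h
    induction h with
    | refl => exact .refl
    | tail _ h ih => exact ih.trans h.reds

theorem Reds.confluent {t u v : Tm} (hu : Reds t u) (hv : Reds t v) :
    ∃ w, Reds u w ∧ Reds v w := by
  simp only [reds_iff_reflTransGen_par] at *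
  exact Relation.church_rosser
    (fun a b c hab hac => ⟨CComega.develop a, .single hab.develop, .single hac.develop⟩) hu hv

theorem Reds.conv {t u : Tm} (h : Reds t u) : Conv t u := by
  induction h with
  | refl => exact .refl _
  | tail _ h ih => exact ih.trans _ _ _ (.rel _ _ h)

theorem Conv.rfl {t : Tm} : Conv t t := Relation.EqvGen.refl _

theorem Conv.symm {t u : Tm} (h : Conv t u) : Conv u t := Relation.EqvGen.symm _ _ h

theorem Conv.trans {t u v : Tm} (h : Conv t u) (h' : Conv u v) : Conv t v :=
  Relation.EqvGen.trans _ _ _ h h'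

theorem Conv.exists_reds {t u : Tm} (h : Conv t u) : ∃ w, Reds t w ∧ Reds u w := by
  induction h with
  | rel t u h => exact ⟨u, .single h, .refl⟩
  | refl t => exact ⟨t, .refl, .refl⟩
  | symm t u _ ih => exact ih.imp fun _ h => h.symm
  | trans t u v _ _ ih₁ ih₂ =>
    obtain ⟨w₁, h₁, h₁'⟩ := ih₁
    obtain ⟨w₂, h₂, h₂'⟩ := ih₂
    obtain ⟨w, hw₁, hw₂⟩ := h₁'.confluent h₂
    exact ⟨w, Relation.ReflTransGen.trans h₁ hw₁, Relation.ReflTransGen.trans h₂' hw₂⟩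

theorem Conv.inst {t u : Tm} (h : Conv t u) (σ : ℕ → Tm) :
    Conv (CComega.inst σ t) (CComega.inst σ u) := by
  induction h with
  | rel t u h => exact ((Par.of_red h).inst fun n => .refl (σ n)).reds.conv
  | refl t => exact .rfl
  | symm t u _ ih => exact ih.symm
  | trans t u v _ _ ih₁ ih₂ => exact ih₁.trans ih₂

theorem Reds.pi_inv {A B T : Tm} (h : Reds (.pi A B) T) :
    ∃ A' B', T = .pi A' B' ∧ Reds A A' ∧ Reds B B' := by
  induction h with
  | refl => exact ⟨A, B, rfl, .refl, .refl⟩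
  | tail _ h ih =>
    obtain ⟨A', B', rfl, hA, hB⟩ := ih
    cases h with
    | piDom _ h => exact ⟨_, _, rfl, hA.tail h, hB⟩
    | piCod _ h => exact ⟨_, _, rfl, hA, hB.tail h⟩

theorem Reds.sort_inv {i : ℕ} {T : Tm} (h : Reds (.sort i) T) : T = .sort i := by
  induction h with
  | refl => rfl
  | tail _ h ih => subst ih; cases h

/-! ### Inversion of cumulativity -/

theorem Cum.inst {T U : Tm} (h : Cum T U) (σ : ℕ → Tm) :
    Cum (CComega.inst σ T) (CComega.inst σ U) := by
  induction h generalizing σ with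
  | ofConv h => exact .ofConv (h.inst σ)
  | sort h => exact .sort h
  | pi h _ ih => exact .pi (h.inst σ) (ih _)
  | trans _ _ ih₁ ih₂ => exact .trans (ih₁ σ) (ih₂ σ)

theorem Cum.exists_reds_sort {T U : Tm} (h : Cum T U) {j : ℕ} (hU : Reds U (.sort j)) :
    ∃ i ≤ j, Reds T (.sort i) := by
  induction h generalizing j with
  | ofConv h =>
    obtain ⟨w, h₁, h₂⟩ := (h.trans hU.conv).exists_reds
    cases h₂.sort_inv
    exact ⟨j, le_rfl, h₁⟩
  | sort h =>
    cases hU.sort_inv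
    exact ⟨_, h, .refl⟩
  | pi _ _ _ =>
    obtain ⟨_, _, h, _⟩ := hU.pi_inv
    cases h
  | trans _ _ ih₁ ih₂ =>
    obtain ⟨i, hi, h⟩ := ih₂ hU
    obtain ⟨k, hk, h'⟩ := ih₁ h
    exact ⟨k, hk.trans hi, h'⟩

theorem Cum.exists_reds_pi {T U : Tm} (h : Cum T U) {A B : Tm} (hU : Reds U (.pi A B)) :
    ∃ A' B', Reds T (.pi A' B') ∧ Conv A' A ∧ Cum B' B := by
  induction h generalizing A B with
  | ofConv h =>
    obtain ⟨w, h₁, h₂⟩ := (h.trans hU.conv).exists_reds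
    obtain ⟨A', B', rfl, hA, hB⟩ := h₂.pi_inv
    exact ⟨A', B', h₁, hA.conv.symm, .ofConv hB.conv.symm⟩
  | sort h => cases hU.sort_inv
  | pi hA hB _ =>
    obtain ⟨A', B', h, hA', hB'⟩ := hU.pi_inv
    cases h
    exact ⟨_, _, .refl, hA.trans hA'.conv, .trans hB (.ofConv hB'.conv)⟩
  | trans _ _ ih₁ ih₂ =>
    obtain ⟨A₁, B₁, h, hA, hB⟩ := ih₂ hU
    obtain ⟨A₂, B₂, h', hA', hB'⟩ := ih₁ h
    exact ⟨A₂, B₂, h', hA'.trans hA, .trans hB' hB⟩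

theorem Cum.sort_inv {i j : ℕ} (h : Cum (.sort i) (.sort j)) : i ≤ j := by
  obtain ⟨k, hk, h⟩ := h.exists_reds_sort .refl
  cases h.sort_inv
  exact hk

theorem Cum.pi_inv {A A' B B' : Tm} (h : Cum (.pi A B) (.pi A' B')) :
    Conv A A' ∧ Cum B B' := by
  obtain ⟨A₁, B₁, h, hA, hB⟩ := h.exists_reds_pi .refl
  obtain ⟨A₂, B₂, h, hA', hB'⟩ := h.pi_inv
  cases h
  exact ⟨hA'.conv.trans hA, .trans (.ofConv hB'.conv) hB⟩

/-! ### Generation lemmas -/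

/-- Induction on typing derivations alone. -/
theorem TypedC.induct {motive : ∀ Γ t T, TypedC Γ t T → Prop}
    (sort : ∀ {Γ i} (h : WfCtxC Γ), motive Γ (.sort i) (.sort (i + 1)) (.sort h))
    (var : ∀ {Γ n A} (h : WfCtxC Γ) (hn : Γ[n]? = some A),
      motive Γ (.var n) (lift (n + 1) 0 A) (.var h hn))
    (pi : ∀ {Γ A B i j} (hA : TypedC Γ A (.sort i)) (hB : TypedC (A :: Γ) B (.sort j)),
      motive _ _ _ hA → motive _ _ _ hB → motive Γ (.pi A B) (.sort (max i j)) (.pi hA hB))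
    (lam : ∀ {Γ A B t i} (hP : TypedC Γ (.pi A B) (.sort i)) (ht : TypedC (A :: Γ) t B),
      motive _ _ _ hP → motive _ _ _ ht → motive Γ (.lam A t) (.pi A B) (.lam hP ht))
    (app : ∀ {Γ t u A B} (ht : TypedC Γ t (.pi A B)) (hu : TypedC Γ u A),
      motive _ _ _ ht → motive _ _ _ hu → motive Γ (.app t u) (subst u 0 B) (.app ht hu))
    (cumul : ∀ {Γ t A B i} (ht : TypedC Γ t A) (hB : TypedC Γ B (.sort i)) (h : Cum A B),
      motive _ _ _ ht → motive _ _ _ hB → motive Γ t B (.cumul ht hB h))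
    {Γ t T} (h : TypedC Γ t T) : motive Γ t T h :=
  TypedC.rec (motive_1 := fun _ _ => True) (motive_2 := motive) trivial
    (fun _ _ _ _ => trivial) (fun h _ => sort h) (fun h hn _ => var h hn)
    pi lam app cumul h

theorem TypedC.wfCtx {Γ : Ctx} {t T : Tm} (h : TypedC Γ t T) : WfCtxC Γ := by
  induction h using TypedC.induct <;> assumption

theorem TypedC.sort_inv {Γ : Ctx} {i : ℕ} {T : Tm} (h : TypedC Γ (.sort i) T) :
    Cum (.sort (i + 1)) T := by
  generalize ht : Tm.sort i = t at h
  induction h using TypedC.induct with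
  | sort => cases ht; exact .ofConv .rfl
  | cumul _ _ h ih => exact (ih ht).trans h
  | _ => cases ht

theorem TypedC.var_inv {Γ : Ctx} {n : ℕ} {T : Tm} (h : TypedC Γ (.var n) T) :
    ∃ A, Γ[n]? = some A ∧ Cum (lift (n + 1) 0 A) T := by
  generalize ht : Tm.var n = t at h
  induction h using TypedC.induct with
  | var _ hn => cases ht; exact ⟨_, hn, .ofConv .rfl⟩
  | cumul _ _ h ih =>
    obtain ⟨A, hA, hc⟩ := ih ht
    exact ⟨A, hA, hc.trans h⟩
  | _ => cases ht

theorem TypedC.pi_inv {Γ : Ctx} {A B T : Tm} (h : TypedC Γ (.pi A B) T) :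
    ∃ i j, TypedC Γ A (.sort i) ∧ TypedC (A :: Γ) B (.sort j) ∧
      Cum (.sort (max i j)) T := by
  generalize ht : Tm.pi A B = t at h
  induction h using TypedC.induct with
  | pi hA hB => cases ht; exact ⟨_, _, hA, hB, .ofConv .rfl⟩
  | cumul _ _ h ih =>
    obtain ⟨i, j, hA, hB, hc⟩ := ih ht
    exact ⟨i, j, hA, hB, hc.trans h⟩
  | _ => cases ht

theorem TypedC.lam_inv {Γ : Ctx} {A t T : Tm} (h : TypedC Γ (.lam A t) T) :
    ∃ B i, TypedC Γ (.pi A B) (.sort i) ∧ TypedC (A :: Γ) t B ∧ Cum (.pi A B) T := by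
  generalize ht : Tm.lam A t = s at h
  induction h using TypedC.induct with
  | lam hP hb => cases ht; exact ⟨_, _, hP, hb, .ofConv .rfl⟩
  | cumul _ _ h ih =>
    obtain ⟨B, i, hP, hb, hc⟩ := ih ht
    exact ⟨B, i, hP, hb, hc.trans h⟩
  | _ => cases ht

theorem TypedC.app_inv {Γ : Ctx} {t u T : Tm} (h : TypedC Γ (.app t u) T) :
    ∃ A B, TypedC Γ t (.pi A B) ∧ TypedC Γ u A ∧ Cum (subst u 0 B) T := by
  generalize ht : Tm.app t u = s at h
  induction h using TypedC.induct with
  | app hf hu => cases ht; exact ⟨_, _, hf, hu, .ofConv .rfl⟩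
  | cumul _ _ h ih =>
    obtain ⟨A, B, hf, hu, hc⟩ := ih ht
    exact ⟨A, B, hf, hu, hc.trans h⟩
  | _ => cases ht

/-! ### Typing of substitutions -/

/-- Typing is stable under every class of substitutions that is closed under extension
below a binder and whose components are well typed. -/
theorem TypedC.inst_of_class (P : Ctx → Ctx → (ℕ → Tm) → Prop)
    (hvar : ∀ {Γ Δ σ n A}, P Γ Δ σ → WfCtxC Δ → Γ[n]? = some A →
      TypedC Δ (σ n) (CComega.inst σ (lift (n + 1) 0 A)))
    (hup : ∀ {Γ Δ σ A}, P Γ Δ σ → WfCtxC (CComega.inst σ A :: Δ) →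
      P (A :: Γ) (CComega.inst σ A :: Δ) (up σ))
    {Γ : Ctx} {t T : Tm} (h : TypedC Γ t T) {Δ : Ctx} {σ : ℕ → Tm} (hΔ : WfCtxC Δ)
    (hσ : P Γ Δ σ) : TypedC Δ (CComega.inst σ t) (CComega.inst σ T) := by
  induction h using TypedC.induct generalizing Δ σ with
  | sort _ => exact .sort hΔ
  | var _ hn => exact hvar hσ hΔ hn
  | pi _ _ ih₁ ih₂ =>
    have hA := ih₁ hΔ hσ
    have hΔ' := WfCtxC.cons hΔ hA
    exact .pi hA (ih₂ hΔ' (hup hσ hΔ'))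
  | lam _ _ ih₁ ih₂ =>
    have hP := ih₁ hΔ hσ
    obtain ⟨i, j, hA, -⟩ := hP.pi_inv
    have hΔ' := WfCtxC.cons hΔ hA
    exact .lam hP (ih₂ hΔ' (hup hσ hΔ'))
  | app _ _ ih₁ ih₂ =>
    rw [inst_subst_zero]
    exact .app (ih₁ hΔ hσ) (ih₂ hΔ hσ)
  | cumul _ _ h ih₁ ih₂ => exact .cumul (ih₁ hΔ hσ) (ih₂ hΔ hσ) (h.inst σ)

/-- `ξ` maps the declarations of `Γ` to declarations of `Δ` with the renamed type. -/
def RenTyped (Γ Δ : Ctx) (ξ : ℕ → ℕ) : Prop :=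
  ∀ n A, Γ[n]? = some A →
    ∃ B, Δ[ξ n]? = some B ∧ lift (ξ n + 1) 0 B = ren ξ (lift (n + 1) 0 A)

theorem TypedC.ren {Γ Δ : Ctx} {t T : Tm} {ξ : ℕ → ℕ} (h : TypedC Γ t T) (hΔ : WfCtxC Δ)
    (hξ : RenTyped Γ Δ ξ) : TypedC Δ (CComega.ren ξ t) (CComega.ren ξ T) := by
  rw [ren_eq_inst, ren_eq_inst]
  refine h.inst_of_class (fun Γ Δ σ => ∃ ξ, σ = (fun n => .var (ξ n)) ∧ RenTyped Γ Δ ξ)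
    ?_ ?_ hΔ ⟨ξ, rfl, hξ⟩
  · rintro Γ Δ _ n A ⟨ξ, rfl, hξ⟩ hΔ hn
    obtain ⟨B, hB, h⟩ := hξ n A hn
    rw [← ren_eq_inst, ← h]
    exact .var hΔ hB
  · rintro Γ Δ _ A ⟨ξ, rfl, hξ⟩ -
    refine ⟨upRen ξ, up_var_comp ξ, ?_⟩
    rintro (_ | n) B hn
    · cases hn
      refine ⟨_, rfl, ?_⟩
      simp only [lift_succ_zero, upRen, lift_zero_zero]
      rw [ren_eq_inst (upRen ξ), ← up_var_comp, inst_up_ren_succ]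
    · obtain ⟨C, hC, h⟩ := hξ n B hn
      refine ⟨C, hC, ?_⟩
      rw [upRen, lift_succ_zero (ξ n + 1), h, lift_succ_zero (n + 1), ren_eq_inst (upRen ξ),
        ← up_var_comp, inst_up_ren_succ, ← ren_eq_inst]

theorem TypedC.weaken {Γ : Ctx} {t T A : Tm} (h : TypedC Γ t T) (hA : WfCtxC (A :: Γ)) :
    TypedC (A :: Γ) (CComega.ren Nat.succ t) (CComega.ren Nat.succ T) :=
  h.ren hA fun _ B hn => ⟨B, hn, lift_succ_zero _ _⟩

/-- `σ` is a well-typed substitution from `Γ` to `Δ`. -/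
def SubstTyped (Γ Δ : Ctx) (σ : ℕ → Tm) : Prop :=
  ∀ n A, Γ[n]? = some A → TypedC Δ (σ n) (inst σ (lift (n + 1) 0 A))

theorem TypedC.inst {Γ Δ : Ctx} {t T : Tm} {σ : ℕ → Tm} (h : TypedC Γ t T) (hΔ : WfCtxC Δ)
    (hσ : SubstTyped Γ Δ σ) : TypedC Δ (CComega.inst σ t) (CComega.inst σ T) := by
  refine h.inst_of_class SubstTyped (fun hσ _ hn => hσ _ _ hn) ?_ hΔ hσ
  rintro Γ Δ σ A hσ hΔ (_ | n) B hn
  · cases hn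
    rw [lift_succ_zero, lift_zero_zero, inst_up_ren_succ]
    have h : TypedC (CComega.inst σ A :: Δ) (.var 0) _ := .var hΔ rfl
    rwa [lift_succ_zero, lift_zero_zero] at h
  · rw [lift_succ_zero, inst_up_ren_succ]
    exact (hσ n B hn).weaken hΔ

theorem TypedC.subst {Γ : Ctx} {A B t u : Tm} (ht : TypedC (A :: Γ) t B)
    (hu : TypedC Γ u A) : TypedC Γ (CComega.subst u 0 t) (CComega.subst u 0 B) := by
  simp only [subst_zero_eq_inst]
  refine ht.inst hu.wfCtx ?_
  rintro (_ | n) C hn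
  · cases hn
    rwa [lift_succ_zero, lift_zero_zero, inst_single_ren_succ]
  · rw [lift_succ_zero, inst_single_ren_succ]
    exact .var hu.wfCtx hn

theorem TypedC.conv_ctx {Γ : Ctx} {A A' t T : Tm} {i : ℕ} (h : TypedC (A :: Γ) t T)
    (hA' : TypedC Γ A' (.sort i)) (hc : Conv A A') : TypedC (A' :: Γ) t T := by
  have hΔ : WfCtxC (A' :: Γ) := .cons hA'.wfCtx hA'
  rw [← inst_var t, ← inst_var T]
  refine h.inst hΔ ?_
  rintro (_ | n) C hn
  · cases hn
    rw [inst_var, lift_succ_zero, lift_zero_zero]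
    cases h.wfCtx with
    | cons _ hA =>
      have h0 : TypedC (A' :: Γ) (.var 0) _ := .var hΔ rfl
      rw [lift_succ_zero, lift_zero_zero] at h0
      refine .cumul h0 (hA.weaken hΔ) (.ofConv ?_)
      rw [ren_eq_inst, ren_eq_inst]
      exact hc.symm.inst _
  · rw [inst_var]
    exact .var hΔ hn

/-! ### Validity and subject reduction -/

theorem WfCtxC.exists_sort {Γ : Ctx} (h : WfCtxC Γ) {n : ℕ} {A : Tm} (hn : Γ[n]? = some A) :
    ∃ i, TypedC Γ (lift (n + 1) 0 A) (.sort i) := by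
  induction Γ generalizing n with
  | nil => cases hn
  | cons B Γ ih =>
    cases h with
    | cons hΓ hB =>
      have hw := WfCtxC.cons hΓ hB
      rw [lift_succ_zero]
      cases n with
      | zero =>
        cases hn
        rw [lift_zero_zero]
        exact ⟨_, hB.weaken hw⟩
      | succ n =>
        obtain ⟨i, hi⟩ := ih hΓ hn
        exact ⟨i, hi.weaken hw⟩

theorem TypedC.exists_sort {Γ : Ctx} {t T : Tm} (h : TypedC Γ t T) :
    ∃ i, TypedC Γ T (.sort i) := by
  induction h using TypedC.induct with
  | sort h => exact ⟨_, .sort h⟩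
  | var h hn => exact h.exists_sort hn
  | pi hA _ => exact ⟨_, .sort hA.wfCtx⟩
  | lam hP _ => exact ⟨_, hP⟩
  | app _ hu ih =>
    obtain ⟨_, hP⟩ := ih
    obtain ⟨_, j, -, hB, -⟩ := hP.pi_inv
    exact ⟨j, hB.subst hu⟩
  | cumul _ hB _ => exact ⟨_, hB⟩

theorem TypedC.cumul_of_typed {Γ : Ctx} {s t T U : Tm} (h : TypedC Γ t T)
    (hs : TypedC Γ s U) (hc : Cum T U) : TypedC Γ t U :=
  hs.exists_sort.elim fun _ hU => .cumul h hU hc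

theorem TypedC.red {Γ : Ctx} {t t' T : Tm} (h : TypedC Γ t T) (hr : Red t t') :
    TypedC Γ t' T := by
  induction hr generalizing Γ T with
  | beta A t u =>
    obtain ⟨A', B', hf, hu, hc⟩ := h.app_inv
    obtain ⟨B, i, hP, ht, hc'⟩ := hf.lam_inv
    obtain ⟨hA, hB⟩ := hc'.pi_inv
    obtain ⟨_, _, hAs, -⟩ := hP.pi_inv
    refine (ht.subst (.cumul hu hAs (.ofConv hA.symm))).cumul_of_typed h (.trans ?_ hc)
    simp only [subst_zero_eq_inst]
    exact hB.inst _
  | piDom B hr ih =>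
    obtain ⟨i, j, hA, hB, hc⟩ := h.pi_inv
    have hA' := ih hA
    exact (TypedC.pi hA' (hB.conv_ctx hA' (.rel _ _ hr))).cumul_of_typed h hc
  | piCod A hr ih =>
    obtain ⟨i, j, hA, hB, hc⟩ := h.pi_inv
    exact (TypedC.pi hA (ih hB)).cumul_of_typed h hc
  | lamDom t hr ih =>
    obtain ⟨B, i, hP, ht, hc⟩ := h.lam_inv
    obtain ⟨k, l, hA, hB, -⟩ := hP.pi_inv
    have hA' := ih hA
    have hAA := Relation.EqvGen.rel _ _ hr
    exact (TypedC.lam (.pi hA' (hB.conv_ctx hA' hAA)) (ht.conv_ctx hA' hAA)).cumul_of_typed h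
      (.trans (.pi (Conv.symm hAA) (.ofConv .rfl)) hc)
  | lamBody A hr ih =>
    obtain ⟨B, i, hP, ht, hc⟩ := h.lam_inv
    exact (TypedC.lam hP (ih ht)).cumul_of_typed h hc
  | appFun u hr ih =>
    obtain ⟨A, B, hf, hu, hc⟩ := h.app_inv
    exact (TypedC.app (ih hf) hu).cumul_of_typed h hc
  | appArg t hr ih =>
    obtain ⟨A, B, hf, hu, hc⟩ := h.app_inv
    exact (TypedC.app hf (ih hu)).cumul_of_typed h
      (.trans (.ofConv ((Par.refl B).subst (Par.of_red hr)).reds.conv.symm) hc)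

theorem TypedC.reds {Γ : Ctx} {t t' T : Tm} (h : TypedC Γ t T) (hr : Reds t t') :
    TypedC Γ t' T := by
  induction hr with
  | refl => exact h
  | tail _ hr ih => exact ih.red hr

theorem TypedC.reds_type {Γ : Ctx} {t T U : Tm} (h : TypedC Γ t T) (hr : Reds T U) :
    TypedC Γ t U :=
  h.exists_sort.elim fun _ hT => .cumul h (hT.reds hr) (.ofConv hr.conv)

/-! ### Principal types -/

/-- `P` is a principal type of `t` in `Γ`. -/
def IsPrincipal (Γ : Ctx) (t P : Tm) : Prop :=
  TypedC Γ t P ∧ ∀ T, TypedC Γ t T → Cum P T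

theorem IsPrincipal.reds {Γ : Ctx} {t P Q : Tm} (h : IsPrincipal Γ t P) (hr : Reds P Q) :
    IsPrincipal Γ t Q :=
  ⟨h.1.reds_type hr, fun T hT => .trans (.ofConv hr.conv.symm) (h.2 T hT)⟩

theorem IsPrincipal.exists_sort {Γ : Ctx} {t P : Tm} {i : ℕ} (h : IsPrincipal Γ t P)
    (ht : TypedC Γ t (.sort i)) : ∃ j, IsPrincipal Γ t (.sort j) := by
  obtain ⟨j, -, hr⟩ := (h.2 _ ht).exists_reds_sort .refl
  exact ⟨j, h.reds hr⟩

theorem IsPrincipal.exists_pi {Γ : Ctx} {t P A B : Tm} (h : IsPrincipal Γ t P)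
    (ht : TypedC Γ t (.pi A B)) : ∃ A' B', IsPrincipal Γ t (.pi A' B') := by
  obtain ⟨A', B', hr, -⟩ := (h.2 _ ht).exists_reds_pi .refl
  exact ⟨A', B', h.reds hr⟩

theorem TypedC.exists_isPrincipal {Γ : Ctx} {t T : Tm} (h : TypedC Γ t T) :
    ∃ P, IsPrincipal Γ t P := by
  induction t generalizing Γ T with
  | var n =>
    obtain ⟨A, hA, -⟩ := h.var_inv
    refine ⟨_, .var h.wfCtx hA, fun T' h' => ?_⟩
    obtain ⟨A', hA', hc⟩ := h'.var_inv
    cases hA.symm.trans hA'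
    exact hc
  | sort i => exact ⟨_, .sort h.wfCtx, fun T' h' => h'.sort_inv⟩
  | pi A B ihA ihB =>
    obtain ⟨i, j, hA, hB, -⟩ := h.pi_inv
    obtain ⟨k, hk⟩ := (ihA hA).elim fun _ hP => hP.exists_sort hA
    obtain ⟨l, hl⟩ := (ihB hB).elim fun _ hP => hP.exists_sort hB
    refine ⟨_, .pi hk.1 hl.1, fun T' h' => ?_⟩
    obtain ⟨i', j', hA', hB', hc⟩ := h'.pi_inv
    exact .trans (.sort (max_le_max (hk.2 _ hA').sort_inv (hl.2 _ hB').sort_inv)) hc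
  | lam A t _ iht =>
    obtain ⟨B, i, hP, ht, -⟩ := h.lam_inv
    obtain ⟨k, l, hA, -⟩ := hP.pi_inv
    obtain ⟨Q, hQ⟩ := iht ht
    obtain ⟨j, hj⟩ := hQ.1.exists_sort
    refine ⟨_, .lam (.pi hA hj) hQ.1, fun T' h' => ?_⟩
    obtain ⟨B', -, -, ht', hc⟩ := h'.lam_inv
    exact .trans (.pi .rfl (hQ.2 _ ht')) hc
  | app t u iht _ =>
    obtain ⟨A, B, ht, hu, -⟩ := h.app_inv
    obtain ⟨A₀, B₀, h₀⟩ := (iht ht).elim fun _ hP => hP.exists_pi ht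
    obtain ⟨_, hP₀⟩ := h₀.1.exists_sort
    obtain ⟨_, _, hA₀, -⟩ := hP₀.pi_inv
    refine ⟨_, .app h₀.1 (.cumul hu hA₀ (.ofConv (h₀.2 _ ht).pi_inv.1.symm)), fun T' h' => ?_⟩
    obtain ⟨A', B', ht', -, hc⟩ := h'.app_inv
    refine .trans ?_ hc
    simp only [subst_zero_eq_inst]
    exact (h₀.2 _ ht').pi_inv.2.inst _

/-- **Existence of principal types.** If `⊢ Γ` and `Γ ⊢ t : T` in the
cumulative undirected system, then `t` has a principal type `P` in `Γ`. -/
theorem principal_types {Γ : Ctx} {t T : Tm} (hΓ : WfCtxC Γ)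
    (h : TypedC Γ t T) :
    ∃ P, TypedC Γ t P ∧ ∀ T', TypedC Γ t T' → Cum P T' :=
  h.exists_isPrincipal

end CComega
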